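/- Let χ1 and χ2 be the substitutions on {a,b} given by χ1(a)=aab, χ1(b)=ab and χ2(a)=baa, χ2(b)=ba. Let u1 be the fixed point of χ1 beginning with the letter a and u2 the fixed point of χ2 beginning with the letter b. Then there is an infinite word u with u1 = a·u and u2 = b·u; equivalently, u1(0)=a, u2(0)=b, and u1(n) = u2(n) for every n ≥ 1. -/

import Mathlib

/- STATEMENT 11: The fixed point u1 of χ1 beginning with a and the fixed point
u2 of χ2 beginning with b agree from the second letter on: u1 = a·u and
u2 = b·u for a common infinite word u. -/

namespace Stmt11

inductive AB : Type
  | a | b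
deriving DecidableEq

/-- Extension of a substitution (letter → word) to finite words. -/
def subst (f : AB → List AB) (w : List AB) : List AB :=
  w.flatMap f

def χ1 : AB → List AB
  | .a => [.a, .a, .b]
  | .b => [.a, .b]

def χ2 : AB → List AB
  | .a => [.b, .a, .a]
  | .b => [.b, .a]

/-- `w` is a (finite) prefix of the infinite word `u`. -/
def IsPrefixOf (w : List AB) (u : ℕ → AB) : Prop :=
  (List.range w.length).map u = w

/-- `u` is a fixed point of `σ` beginning with the letter `x`. -/
def IsFixedPointOf (σ : AB → List AB) (x : AB) (u : ℕ → AB) : Prop :=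
  ∀ k : ℕ, IsPrefixOf ((subst σ)^[k] [x]) u

theorem subst_append (f : AB → List AB) (v w : List AB) :
    subst f (v ++ w) = subst f v ++ subst f w := by
  simp [subst]

theorem subst_cons (f : AB → List AB) (x : AB) (w : List AB) :
    subst f (x :: w) = f x ++ subst f w := by
  simp [subst]

/-- The substitutions `χ1` and `χ2` are conjugate by the letter `b`. -/
theorem subst_χ2_append_b (w : List AB) :
    subst χ2 w ++ [AB.b] = AB.b :: subst χ1 w := by
  induction w with
  | nil => rfl
  | cons x w ih =>
    rw [subst_cons, subst_cons, List.append_assoc, ih]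
    cases x <;> rfl

theorem length_le_length_subst_χ2 (w : List AB) : w.length ≤ (subst χ2 w).length := by
  induction w with
  | nil => exact Nat.zero_le _
  | cons x w ih =>
    rw [subst_cons, List.length_append, List.length_cons]
    cases x <;> simp only [χ2, List.length_cons, List.length_nil] <;> omega

theorem exists_iterate_eq_cons (k : ℕ) : ∃ p q : List AB,
    (subst χ1)^[k] [AB.a] = AB.a :: p ∧ (subst χ2)^[k] [AB.b] = AB.b :: q ∧
      q <+: p ∧ k ≤ q.length := by
  induction k with
  | zero => exact ⟨[], [], rfl, rfl, List.prefix_rfl, le_rfl⟩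
  | succ k ih =>
    obtain ⟨p, q, hp, hq, ⟨r, rfl⟩, hk⟩ := ih
    refine ⟨AB.a :: AB.b :: subst χ1 (q ++ r), AB.a :: subst χ2 q, ?_, ?_, ?_, ?_⟩
    · rw [Function.iterate_succ_apply', hp, subst_cons]; rfl
    · rw [Function.iterate_succ_apply', hq, subst_cons]; rfl
    · refine ⟨AB.b :: subst χ1 r, ?_⟩
      rw [subst_append, ← List.cons_append, ← subst_χ2_append_b q]
      simp
    · have := length_le_length_subst_χ2 q
      rw [List.length_cons]
      omega

theorem IsPrefixOf.getElem_eq {w : List AB} {u : ℕ → AB} (h : IsPrefixOf w u) {n : ℕ}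
    (hn : n < w.length) : w[n] = u n := by
  have h' : ((List.range w.length).map u)[n]? = w[n]? := congrArg (·[n]?) h
  simpa [hn, eq_comm] using h'

theorem fixed_points_agree_after_first_letter
    (u1 u2 : ℕ → AB)
    (h1 : IsFixedPointOf χ1 .a u1) (h2 : IsFixedPointOf χ2 .b u2) :
    u1 0 = AB.a ∧ u2 0 = AB.b ∧ ∀ n : ℕ, 1 ≤ n → u1 n = u2 n := by
  refine ⟨((h1 0).getElem_eq Nat.zero_lt_one).symm, ((h2 0).getElem_eq Nat.zero_lt_one).symm, ?_⟩
  intro n hn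
  obtain ⟨m, rfl⟩ := Nat.exists_eq_add_of_le' hn
  obtain ⟨p, q, hp, hq, hqp, hm⟩ := exists_iterate_eq_cons (m + 1)
  have h1' := h1 (m + 1)
  have h2' := h2 (m + 1)
  rw [hp] at h1'
  rw [hq] at h2'
  have hlen := hqp.length_le
  rw [← h1'.getElem_eq (by rw [List.length_cons]; omega),
    ← h2'.getElem_eq (by rw [List.length_cons]; omega)]
  exact (hqp.getElem (by omega)).symm

end Stmt11
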